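/- arXiv:1504.03529 — 2 statements merged into one kernel-verified Lean document; each statement's English description precedes it below -/
import Mathlib

section
/- Under Assumption A1, the family of posterior measures μ^z is a regular conditional distribution of U given Z = G(U) + ε. Precisely: (i) for every z ∈ ℝ^d, μ^z is a Borel probability measure on 𝒳; (ii) for every B ∈ ℬ(𝒳) the map z ↦ μ^z(B) is Borel measurable; and (iii) for all A ∈ ℬ(ℝ^d) and B ∈ ℬ(𝒳), ℙ(U ∈ B, Z ∈ A) = ∫_A μ^z(B) ν_Z(dz), where ν_Z denotes the law of Z. -/
open MeasureTheory ProbabilityTheory Filter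
open scoped ENNReal

/-- Under Assumption A1 the family of posterior measures
`μ^z(du) = γ(z)⁻¹ exp(-ℓ(z - G u)) μ₀(du)` is a regular conditional distribution of `U`
given `Z = G(U) + ε`: each `μ^z` is a Borel probability measure, `z ↦ μ^z(B)` is
Borel measurable for each Borel `B`, and
`P(U ∈ B, Z ∈ A) = ∫_A μ^z(B) ν_Z(dz)` where `ν_Z` is the law of `Z`. -/
theorem posterior_is_regular_conditional_distribution
    {Ω : Type*} [MeasurableSpace Ω] (P : Measure Ω) [IsProbabilityMeasure P]
    {X : Type*} [NormedAddCommGroup X] [InnerProductSpace ℝ X]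
    [CompleteSpace X] [SecondCountableTopology X] [MeasurableSpace X] [BorelSpace X]
    {d : ℕ}
    (μ₀ : Measure X) [IsProbabilityMeasure μ₀]
    (ℓ : EuclideanSpace ℝ (Fin d) → ℝ) (hℓmeas : Measurable ℓ) (hℓnonneg : ∀ e, 0 ≤ ℓ e)
    (C : ℝ) (hC : 0 < C)
    (G : X → EuclideanSpace ℝ (Fin d)) (hG : Continuous G)
    (U : Ω → X) (hUmeas : Measurable U) (hUlaw : Measure.map U P = μ₀)
    (ε : Ω → EuclideanSpace ℝ (Fin d)) (hεmeas : Measurable ε)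
    (hεlaw : Measure.map ε P =
      volume.withDensity (fun e => ENNReal.ofReal (C * Real.exp (-ℓ e))))
    (hindep : IndepFun U ε P)
    (Z : Ω → EuclideanSpace ℝ (Fin d)) (hZ : ∀ ω, Z ω = G (U ω) + ε ω)
    (γ : EuclideanSpace ℝ (Fin d) → ℝ)
    (hγ : ∀ z, γ z = ∫ u, Real.exp (-ℓ (z - G u)) ∂μ₀)
    (post : EuclideanSpace ℝ (Fin d) → Measure X)
    (hpost : ∀ z, post z =
      (ENNReal.ofReal (γ z))⁻¹ •
        μ₀.withDensity (fun u => ENNReal.ofReal (Real.exp (-ℓ (z - G u))))) :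
    (∀ z, IsProbabilityMeasure (post z)) ∧
    (∀ B : Set X, MeasurableSet B → Measurable (fun z => post z B)) ∧
    (∀ (A : Set (EuclideanSpace ℝ (Fin d))) (B : Set X),
      MeasurableSet A → MeasurableSet B →
      P (U ⁻¹' B ∩ Z ⁻¹' A) = ∫⁻ z in A, post z B ∂(Measure.map Z P)) := by
  have hGm : Measurable G := hG.measurable
  set f : EuclideanSpace ℝ (Fin d) → X → ℝ≥0∞ :=
    fun z u => ENNReal.ofReal (Real.exp (-ℓ (z - G u))) with hf
  have hfm : Measurable (Function.uncurry f) := by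
    simp only [hf, Function.uncurry_def]
    fun_prop
  have hfz : ∀ z, Measurable (f z) := fun z => hfm.comp measurable_prodMk_left
  have hexpInt : ∀ z, Integrable (fun u => Real.exp (-ℓ (z - G u))) μ₀ := by
    intro z
    refine Integrable.of_bound (C := 1) ?_ ?_
    · exact Measurable.aestronglyMeasurable (by fun_prop)
    · refine Eventually.of_forall fun u => ?_
      rw [Real.norm_eq_abs, abs_of_pos (Real.exp_pos _)]
      exact Real.exp_le_one_iff.2 (by linarith [hℓnonneg (z - G u)])
  have hg : ∀ z, ENNReal.ofReal (γ z) = ∫⁻ u, f z u ∂μ₀ := by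
    intro z
    rw [hγ z]
    exact ofReal_integral_eq_lintegral_ofReal (hexpInt z)
      (Eventually.of_forall fun u => (Real.exp_pos _).le)
  have hgpos : ∀ z, ENNReal.ofReal (γ z) ≠ 0 := by
    intro z
    have : 0 < γ z := by
      rw [hγ z]
      exact integral_exp_pos (hexpInt z)
    simpa using this
  have hgtop : ∀ z, ENNReal.ofReal (γ z) ≠ ∞ := fun z => ENNReal.ofReal_ne_top
  have hpB : ∀ z (B : Set X), MeasurableSet B →
      post z B = (ENNReal.ofReal (γ z))⁻¹ * ∫⁻ u in B, f z u ∂μ₀ := by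
    intro z B hB
    rw [hpost z, Measure.smul_apply, withDensity_apply _ hB, smul_eq_mul]
  have hpm : ∀ B : Set X, MeasurableSet B → Measurable (fun z => post z B) := by
    intro B hB
    simp_rw [hpB _ B hB, hg]
    exact (Measurable.lintegral_prod_right' hfm).inv.mul (Measurable.lintegral_prod_right' hfm)
  have hZm : Measurable Z := by
    have : Z = fun ω => G (U ω) + ε ω := funext hZ
    rw [this]
    fun_prop
  have key : ∀ h : X × EuclideanSpace ℝ (Fin d) → ℝ≥0∞, Measurable h →
      ∫⁻ ω, h (U ω, Z ω) ∂P =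
        ∫⁻ z, ∫⁻ u, ENNReal.ofReal C * f z u * h (u, z) ∂μ₀ := by
    intro h hh
    have hjoint := (indepFun_iff_map_prod_eq_prod_map_map hUmeas.aemeasurable
      hεmeas.aemeasurable).1 hindep
    have hk : Measurable (fun p : X × EuclideanSpace ℝ (Fin d) => h (p.1, G p.1 + p.2)) := by
      fun_prop
    have hprob : IsProbabilityMeasure (Measure.map ε P) :=
      Measure.isProbabilityMeasure_map hεmeas.aemeasurable
    have h1 : ∫⁻ ω, h (U ω, Z ω) ∂P = ∫⁻ u, ∫⁻ e, h (u, G u + e) ∂(Measure.map ε P) ∂μ₀ := by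
      calc ∫⁻ ω, h (U ω, Z ω) ∂P
          = ∫⁻ p, h (p.1, G p.1 + p.2) ∂(Measure.map (fun ω => (U ω, ε ω)) P) := by
            rw [lintegral_map hk (hUmeas.prodMk hεmeas)]
            simp_rw [hZ]
        _ = _ := by
            rw [hjoint, hUlaw]
            exact lintegral_prod _ hk.aemeasurable
    have h2 : ∀ u, ∫⁻ e, h (u, G u + e) ∂(Measure.map ε P) =
        ∫⁻ z, ENNReal.ofReal C * f z u * h (u, z) := by
      intro u
      rw [hεlaw, lintegral_withDensity_eq_lintegral_mul _ (by fun_prop) (by fun_prop)]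
      rw [← lintegral_add_left_eq_self (fun z => ENNReal.ofReal C * f z u * h (u, z)) (G u)]
      refine lintegral_congr fun e => ?_
      simp only [Pi.mul_apply, hf, add_sub_cancel_left]
      rw [ENNReal.ofReal_mul hC.le]
    rw [h1]
    simp_rw [h2]
    refine lintegral_lintegral_swap ?_
    refine Measurable.aemeasurable ?_
    have : Measurable (fun p : X × EuclideanSpace ℝ (Fin d) => f p.2 p.1) :=
      hfm.comp measurable_swap
    simp only [Function.uncurry_def]
    exact (measurable_const.mul this).mul hh
  refine ⟨?_, hpm, ?_⟩
  · intro z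
    refine ⟨?_⟩
    rw [hpB z _ MeasurableSet.univ, Measure.restrict_univ, ← hg z]
    exact ENNReal.inv_mul_cancel (hgpos z) (hgtop z)
  · intro A B hA hB
    have hL : P (U ⁻¹' B ∩ Z ⁻¹' A) =
        ∫⁻ ω, (B ×ˢ A).indicator (fun _ => (1 : ℝ≥0∞)) (U ω, Z ω) ∂P := by
      rw [← lintegral_indicator_one ((hUmeas hB).inter (hZm hA))]
      rfl
    have hR : ∫⁻ z in A, post z B ∂(Measure.map Z P) =
        ∫⁻ ω, (fun p : X × EuclideanSpace ℝ (Fin d) =>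
          A.indicator (fun z => post z B) p.2) (U ω, Z ω) ∂P := by
      rw [← lintegral_indicator hA, lintegral_map ((hpm B hB).indicator hA) hZm]
    rw [hL, hR, key _ (measurable_const.indicator (hB.prod hA)),
      key (fun p => A.indicator (fun z => post z B) p.2)
        (((hpm B hB).indicator hA).comp measurable_snd)]
    refine lintegral_congr fun z => ?_
    dsimp only
    by_cases hz : z ∈ A
    · have e1 : ∀ u, ENNReal.ofReal C * f z u *
          (B ×ˢ A).indicator (fun _ => (1 : ℝ≥0∞)) (u, z) =
          B.indicator (fun u => ENNReal.ofReal C * f z u) u := by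
        intro u
        by_cases hu : u ∈ B <;> simp [hu, hz]
      simp_rw [e1]
      rw [lintegral_indicator hB, lintegral_const_mul _ (hfz z),
        lintegral_mul_const _ ((hfz z).const_mul _), lintegral_const_mul _ (hfz z),
        Set.indicator_of_mem hz, hpB z B hB, ← hg z, mul_assoc, ← mul_assoc (ENNReal.ofReal (γ z)),
        ENNReal.mul_inv_cancel (hgpos z) (hgtop z), one_mul]
    · simp [hz]
end

section
/- Equip ℝ² with the norm ‖v‖ = |v₁| + |v₂|. Let X = (X₁, X₂) where X₁, X₂ are independent random variables with ℙ(X₁ = −1) = p₁ = 1 − ℙ(X₁ = 1) and ℙ(X₂ = −1) = p₂ = 1 − ℙ(X₂ = 1), with p₁, p₂ ∈ (0,1). Then 𝔼[X] minimizes the functional v ↦ 𝔼[‖X − v‖²] over v ∈ ℝ² if and only if p₁ = p₂ = 1/2. -/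
open MeasureTheory ProbabilityTheory Filter
open scoped ENNReal

lemma rademacher_ae {Ω : Type*} [MeasurableSpace Ω] (P : Measure Ω) [IsProbabilityMeasure P]
    (X : Ω → ℝ) (hX : Measurable X) (p : ℝ) (hp : p ∈ Set.Ioo (0 : ℝ) 1)
    (hn : P {ω | X ω = -1} = ENNReal.ofReal p)
    (hq : P {ω | X ω = 1} = ENNReal.ofReal (1 - p)) :
    (∀ᵐ ω ∂P, X ω = -1 ∨ X ω = 1) ∧ Integrable X P ∧ ∫ ω, X ω ∂P = 1 - 2 * p := by
  have mA : MeasurableSet {ω | X ω = -1} := hX (measurableSet_singleton (-1 : ℝ))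
  have mB : MeasurableSet {ω | X ω = 1} := hX (measurableSet_singleton (1 : ℝ))
  have hd : Disjoint {ω | X ω = -1} {ω | X ω = 1} := by
    rw [Set.disjoint_left]
    intro ω h1 h2
    simp only [Set.mem_setOf_eq] at h1 h2
    linarith
  have hU : P ({ω | X ω = -1} ∪ {ω | X ω = 1}) = 1 := by
    rw [measure_union hd mB, hn, hq, ← ENNReal.ofReal_add hp.1.le (by linarith [hp.2])]
    simp
  have hae : ∀ᵐ ω ∂P, X ω = -1 ∨ X ω = 1 := by
    have := (prob_compl_eq_zero_iff (mA.union mB)).2 hU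
    exact this
  have heq : X =ᵐ[P] fun ω => 1 - 2 * Set.indicator {ω | X ω = -1} (fun _ => (1 : ℝ)) ω := by
    filter_upwards [hae] with ω h
    rcases h with h | h
    · simp [Set.indicator, h]; norm_num
    · simp [Set.indicator, h]; norm_num
  have hi : Integrable (Set.indicator {ω | X ω = -1} (fun _ => (1 : ℝ))) P :=
    (integrable_const 1).indicator mA
  refine ⟨hae, ((integrable_const 1).sub (hi.const_mul 2)).congr heq.symm, ?_⟩
  rw [integral_congr_ae heq, integral_sub (integrable_const 1) (hi.const_mul 2),
    integral_const_mul, integral_indicator mA]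
  simp [Measure.real, hn, hp.1.le]

lemma quad_decrease (a b : ℝ) (ha : a ∈ Set.Ioo (-1 : ℝ) 1) (hb : b ∈ Set.Ioo (-1 : ℝ) 1)
    (F : ℝ → ℝ)
    (hF : ∀ x ∈ Set.Icc (-1 : ℝ) 1, F x = 4 + x ^ 2 + b ^ 2 - 4 * a * x - 4 * b * b
      + 2 * (a * b) * (x * b))
    (h : ∀ x, F a ≤ F x) : a = 0 := by
  obtain ⟨h1, h2⟩ := ha
  obtain ⟨h3, h4⟩ := hb
  by_contra h0
  have ha2 : 0 < a ^ 2 := by positivity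
  have hA : 0 < 1 - a ^ 2 := by nlinarith
  have hB : 0 < 1 - b ^ 2 := by nlinarith
  obtain ⟨c, hc⟩ : ∃ c, c = (1 - b ^ 2) * (1 - a ^ 2) / 2 := ⟨_, rfl⟩
  have hc0 : 0 < c := by rw [hc]; positivity
  have hc1 : c ≤ (1 - a ^ 2) / 2 := by rw [hc]; nlinarith [sq_nonneg b]
  have hc2 : c ≤ (1 - b ^ 2) := by rw [hc]; nlinarith [sq_nonneg a]
  have hx : a * (1 + c) ∈ Set.Icc (-1 : ℝ) 1 := by
    rw [Set.mem_Icc, ← abs_le, abs_mul, abs_of_pos (by linarith : 0 < 1 + c)]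
    have hab : |a| < 1 := abs_lt.2 ⟨h1, h2⟩
    have h5 := abs_nonneg a
    rw [← sq_abs a] at hc1
    have h6 := mul_le_mul_of_nonneg_left hc1 h5
    nlinarith [mul_nonneg (sq_nonneg (|a| - 1)) (by linarith : 0 ≤ |a| + 2)]
  have h7 := h (a * (1 + c))
  rw [hF _ hx, hF a ⟨h1.le, h2.le⟩] at h7
  have h8 : 0 < (c * a ^ 2) * (2 * (1 - b ^ 2) - c) := by
    apply mul_pos (by positivity); linarith
  nlinarith

/-- Equip `ℝ²` with the norm `‖v‖ = |v₁| + |v₂|` and let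
`X = (X₁, X₂)` with `X₁, X₂` independent, `P(Xᵢ = −1) = pᵢ = 1 − P(Xᵢ = 1)`,
`pᵢ ∈ (0,1)`. Then `𝔼[X]` minimizes `v ↦ 𝔼‖X − v‖²` if and only if
`p₁ = p₂ = 1/2`. -/
theorem mean_minimizes_iff_half
    {Ω : Type*} [MeasurableSpace Ω] (P : Measure Ω) [IsProbabilityMeasure P]
    (X₁ X₂ : Ω → ℝ) (hX₁ : Measurable X₁) (hX₂ : Measurable X₂)
    (hindep : IndepFun X₁ X₂ P)
    (p₁ p₂ : ℝ) (hp₁ : p₁ ∈ Set.Ioo (0 : ℝ) 1) (hp₂ : p₂ ∈ Set.Ioo (0 : ℝ) 1)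
    (h₁n : P {ω | X₁ ω = -1} = ENNReal.ofReal p₁)
    (h₁p : P {ω | X₁ ω = 1} = ENNReal.ofReal (1 - p₁))
    (h₂n : P {ω | X₂ ω = -1} = ENNReal.ofReal p₂)
    (h₂p : P {ω | X₂ ω = 1} = ENNReal.ofReal (1 - p₂)) :
    (∀ v : ℝ × ℝ,
        ∫ ω, (|X₁ ω - ∫ ω', X₁ ω' ∂P| + |X₂ ω - ∫ ω', X₂ ω' ∂P|) ^ 2 ∂P
          ≤ ∫ ω, (|X₁ ω - v.1| + |X₂ ω - v.2|) ^ 2 ∂P)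
      ↔ (p₁ = 1 / 2 ∧ p₂ = 1 / 2) := by
  obtain ⟨ae1, i1, e1⟩ := rademacher_ae P X₁ hX₁ p₁ hp₁ h₁n h₁p
  obtain ⟨ae2, i2, e2⟩ := rademacher_ae P X₂ hX₂ p₂ hp₂ h₂n h₂p
  have i12 : Integrable (fun ω => X₁ ω * X₂ ω) P := hindep.integrable_mul i1 i2
  have e12 : ∫ ω, X₁ ω * X₂ ω ∂P = (1 - 2 * p₁) * (1 - 2 * p₂) := by
    rw [← e1, ← e2]
    exact hindep.integral_fun_mul_eq_mul_integral hX₁.aestronglyMeasurable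
      hX₂.aestronglyMeasurable
  have lin : ∀ c0 c1 c2 c3 : ℝ,
      Integrable (fun ω => c0 + c1 * X₁ ω + c2 * X₂ ω + c3 * (X₁ ω * X₂ ω)) P ∧
      ∫ ω, (c0 + c1 * X₁ ω + c2 * X₂ ω + c3 * (X₁ ω * X₂ ω)) ∂P
        = c0 + c1 * (1 - 2 * p₁) + c2 * (1 - 2 * p₂)
          + c3 * ((1 - 2 * p₁) * (1 - 2 * p₂)) := by
    intro c0 c1 c2 c3
    have j0 : Integrable (fun _ : Ω => c0) P := integrable_const c0
    have j1 : Integrable (fun ω => c0 + c1 * X₁ ω) P := j0.add (i1.const_mul c1)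
    have j2 : Integrable (fun ω => c0 + c1 * X₁ ω + c2 * X₂ ω) P := j1.add (i2.const_mul c2)
    refine ⟨j2.add (i12.const_mul c3), ?_⟩
    rw [integral_add j2 (i12.const_mul c3), integral_add j1 (i2.const_mul c2),
      integral_add j0 (i1.const_mul c1), integral_const_mul, integral_const_mul,
      integral_const_mul, e1, e2, e12]
    simp
  have box : ∀ x ∈ Set.Icc (-1 : ℝ) 1, ∀ y ∈ Set.Icc (-1 : ℝ) 1,
      ∫ ω, (|X₁ ω - x| + |X₂ ω - y|) ^ 2 ∂P
        = 4 + x ^ 2 + y ^ 2 - 4 * (1 - 2 * p₁) * x - 4 * (1 - 2 * p₂) * y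
          + 2 * ((1 - 2 * p₁) * (1 - 2 * p₂)) * (x * y) := by
    intro x hx y hy
    have key : ∀ s t : ℝ, t ∈ Set.Icc (-1 : ℝ) 1 → (s = -1 ∨ s = 1) → |s - t| = 1 - s * t := by
      rintro s t ⟨ht1, ht2⟩ (rfl | rfl)
      · rw [abs_of_nonpos (by linarith)]; ring
      · rw [abs_of_nonneg (by linarith)]; ring
    have : (fun ω => (|X₁ ω - x| + |X₂ ω - y|) ^ 2) =ᵐ[P] fun ω =>
        (4 + x ^ 2 + y ^ 2) + (-4 * x) * X₁ ω + (-4 * y) * X₂ ω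
          + (2 * x * y) * (X₁ ω * X₂ ω) := by
      filter_upwards [ae1, ae2] with ω h1 h2
      rw [key _ _ hx h1, key _ _ hy h2]
      rcases h1 with h1 | h1 <;> rcases h2 with h2 | h2 <;> rw [h1, h2] <;> ring
    rw [integral_congr_ae this, (lin _ _ _ _).2]
    ring
  rw [e1, e2]
  have m1 : 1 - 2 * p₁ ∈ Set.Ioo (-1 : ℝ) 1 := ⟨by linarith [hp₁.2], by linarith [hp₁.1]⟩
  have m2 : 1 - 2 * p₂ ∈ Set.Ioo (-1 : ℝ) 1 := ⟨by linarith [hp₂.2], by linarith [hp₂.1]⟩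
  constructor
  · intro h
    have r1 := quad_decrease _ _ m1 m2
      (fun x => ∫ ω, (|X₁ ω - x| + |X₂ ω - (1 - 2 * p₂)|) ^ 2 ∂P)
      (fun x hx => box x hx _ ⟨m2.1.le, m2.2.le⟩) (fun x => h (x, 1 - 2 * p₂))
    have r2 := quad_decrease _ _ m2 m1
      (fun y => ∫ ω, (|X₁ ω - (1 - 2 * p₁)| + |X₂ ω - y|) ^ 2 ∂P)
      (fun y hy => (box _ ⟨m1.1.le, m1.2.le⟩ y hy).trans (by ring))
      (fun y => h (1 - 2 * p₁, y))
    exact ⟨by linarith, by linarith⟩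
  · rintro ⟨q1, q2⟩ ⟨x, y⟩
    rw [box _ ⟨m1.1.le, m1.2.le⟩ _ ⟨m2.1.le, m2.2.le⟩]
    have key : ∀ s t : ℝ, (s = -1 ∨ s = 1) → 1 - s * t ≤ |s - t| ∧ |s - t| ≤ 1 + |t| := by
      rintro s t (rfl | rfl)
      · exact ⟨by linarith [neg_abs_le (-1 - t)], (abs_sub _ _).trans (by simp)⟩
      · exact ⟨by linarith [le_abs_self (1 - t)], (abs_sub _ _).trans (by simp)⟩
    have hsqi : Integrable (fun ω => (|X₁ ω - x| + |X₂ ω - y|) ^ 2) P := by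
      refine Integrable.of_bound (C := (1 + |x| + (1 + |y|)) ^ 2)
        (by measurability) ?_
      filter_upwards [ae1, ae2] with ω h1 h2
      rw [Real.norm_eq_abs, abs_of_nonneg (by positivity)]
      have := (key _ x h1).2
      have := (key _ y h2).2
      gcongr
    have hle := integral_mono_ae (lin 4 (-4 * x) (-4 * y) 0).1 hsqi (by
      filter_upwards [ae1, ae2] with ω h1 h2
      have := (key _ x h1).1
      have := (key _ y h2).1
      nlinarith [sq_nonneg (|X₁ ω - x| + |X₂ ω - y| - 2)])
    rw [(lin _ _ _ _).2] at hle
    refine le_trans (le_of_eq ?_) hle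
    rw [q1, q2]; ring
end
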